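/- The Fourier projection F_n is the unique projection in 𝒫(C(2π), Π_n) that commutes with all translations: if P ∈ 𝒫(C(2π), Π_n) satisfies P ∘ T_g = T_g ∘ P for every g ∈ ℝ, where (T_g f)(t) = f(t+g), then P = F_n. -/

import Mathlib

open MeasureTheory
open scoped Real ENNReal

instance : Fact (0 < 2 * π) := ⟨by positivity⟩

/-- `C(2π)`: continuous `2π`-periodic real-valued functions with the sup norm. -/
abbrev C2pi : Type := C(AddCircle (2 * π), ℝ)

/-- `cos (k t)` as an element of `C(2π)`. -/
noncomputable def cosF (k : ℕ) : C2pi :=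
  ⟨fun t => (fourier (T := 2 * π) k t).re, (Complex.continuous_re.comp (map_continuous _))⟩

/-- `sin (k t)` as an element of `C(2π)`. -/
noncomputable def sinF (k : ℕ) : C2pi :=
  ⟨fun t => (fourier (T := 2 * π) k t).im, (Complex.continuous_im.comp (map_continuous _))⟩

/-- `Π_n`: the space of trigonometric polynomials of degree at most `n`. -/
noncomputable def trigPoly (n : ℕ) : Submodule ℝ C2pi :=
  Submodule.span ℝ {f : C2pi | ∃ k : ℕ, k ≤ n ∧ (f = cosF k ∨ f = sinF k)}

/-- The `L²`-inner-product coefficient functional `f ↦ ∫₀^{2π} f(t) g(t) dt`. -/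
noncomputable def coeffCLM (g : C2pi) : C2pi →L[ℝ] ℝ :=
  (innerSL ℝ (ContinuousMap.toLp (E := ℝ) 2 volume ℝ g)).comp
    (ContinuousMap.toLp (E := ℝ) 2 volume ℝ)

/-- The Fourier projection `F_n : C(2π) → Π_n`, sending `f` to its `n`-th Fourier
partial sum. -/
noncomputable def fourierProj (n : ℕ) : C2pi →L[ℝ] C2pi :=
  (1 / (2 * π)) • (coeffCLM (cosF 0)).smulRight (cosF 0) +
    ∑ k ∈ Finset.Icc 1 n,
      ((1 / π) • ((coeffCLM (cosF k)).smulRight (cosF k) +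
        (coeffCLM (sinF k)).smulRight (sinF k)))

/-- Translation operator `(T_g f)(t) = f(t + g)` on `C(2π)`. -/
noncomputable def translateBy (g : ℝ) (f : C2pi) : C2pi :=
  f.comp ⟨fun t => t + (g : AddCircle (2 * π)), by continuity⟩

theorem integral_fourier (m : ℤ) :
    ∫ t : AddCircle (2 * π), fourier m t = if m = 0 then ((2 * π : ℝ) : ℂ) else 0 := by
  split_ifs with h
  · subst h
    simp only [fourier_zero, integral_const, measureReal_def, AddCircle.measure_univ]
    rw [ENNReal.toReal_ofReal (by positivity)]
    simp
  · exact integral_eq_zero_of_add_right_eq_neg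
      (fourier_add_half_inv_index h (by positivity : 0 < 2 * π))

theorem integrable_of_continuous {E : Type*} [NormedAddCommGroup E]
    {f : AddCircle (2 * π) → E} (hf : Continuous f) : Integrable f :=
  hf.integrable_of_hasCompactSupport (HasCompactSupport.of_compactSpace f)

theorem integral_re_fourier (m : ℤ) :
    ∫ t : AddCircle (2 * π), (fourier m t).re = if m = 0 then 2 * π else 0 := by
  have h := integral_re (integrable_of_continuous (map_continuous (fourier (T := 2 * π) m)))
  rw [integral_fourier] at h
  refine h.trans ?_
  split_ifs
  · exact Complex.ofReal_re _
  · simp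

theorem integral_im_fourier (m : ℤ) :
    ∫ t : AddCircle (2 * π), (fourier m t).im = 0 := by
  have h := integral_im (integrable_of_continuous (map_continuous (fourier (T := 2 * π) m)))
  rw [integral_fourier] at h
  refine h.trans ?_
  split_ifs
  · exact Complex.ofReal_im (2 * π)
  · simp

theorem integrable_re_fourier (m : ℤ) :
    Integrable fun t : AddCircle (2 * π) => (fourier m t).re :=
  integrable_of_continuous (Complex.continuous_re.comp (map_continuous _))

theorem integrable_im_fourier (m : ℤ) :
    Integrable fun t : AddCircle (2 * π) => (fourier m t).im :=
  integrable_of_continuous (Complex.continuous_im.comp (map_continuous _))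

theorem cosF_apply (k : ℕ) (t : AddCircle (2 * π)) :
    cosF k t = (fourier (k : ℤ) t).re := rfl

theorem sinF_apply (k : ℕ) (t : AddCircle (2 * π)) :
    sinF k t = (fourier (k : ℤ) t).im := rfl

theorem fourier_sub_apply (m n : ℤ) (t : AddCircle (2 * π)) :
    fourier (m - n) t = fourier m t * (starRingEnd ℂ) (fourier n t) := by
  rw [sub_eq_add_neg, fourier_add, fourier_neg]

theorem coeffCLM_apply (g f : C2pi) : coeffCLM g f = ∫ t, f t * g t :=
  ContinuousMap.inner_toLp volume g f

theorem coeffCLM_comm (g f : C2pi) : coeffCLM g f = coeffCLM f g := by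
  simp only [coeffCLM_apply, mul_comm]

theorem coeffCLM_cosF_cosF (j k : ℕ) : coeffCLM (cosF j) (cosF k) =
    ((if (k : ℤ) - j = 0 then 2 * π else 0) + if (k : ℤ) + j = 0 then 2 * π else 0) / 2 := by
  rw [← integral_re_fourier, ← integral_re_fourier,
    ← integral_add (integrable_re_fourier _) (integrable_re_fourier _), ← integral_div,
    coeffCLM_apply]
  refine integral_congr_ae (.of_forall fun t => ?_)
  simp only [cosF_apply, fourier_sub_apply, fourier_add, Complex.mul_re, Complex.conj_re,
    Complex.conj_im]
  ring

theorem coeffCLM_sinF_sinF (j k : ℕ) : coeffCLM (sinF j) (sinF k) =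
    ((if (k : ℤ) - j = 0 then 2 * π else 0) - if (k : ℤ) + j = 0 then 2 * π else 0) / 2 := by
  rw [← integral_re_fourier, ← integral_re_fourier,
    ← integral_sub (integrable_re_fourier _) (integrable_re_fourier _), ← integral_div,
    coeffCLM_apply]
  refine integral_congr_ae (.of_forall fun t => ?_)
  simp only [sinF_apply, fourier_sub_apply, fourier_add, Complex.mul_re, Complex.conj_re,
    Complex.conj_im]
  ring

theorem coeffCLM_sinF_cosF (j k : ℕ) : coeffCLM (sinF j) (cosF k) = 0 := by
  have h : ∫ t : AddCircle (2 * π),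
      ((fourier ((k : ℤ) + j) t).im - (fourier ((k : ℤ) - j) t).im) / 2 = 0 := by
    rw [integral_div, integral_sub (integrable_im_fourier _) (integrable_im_fourier _),
      integral_im_fourier, integral_im_fourier]
    simp
  rw [coeffCLM_apply, ← h]
  refine integral_congr_ae (.of_forall fun t => ?_)
  simp only [sinF_apply, cosF_apply, fourier_sub_apply, fourier_add, Complex.mul_im,
    Complex.conj_re, Complex.conj_im]
  ring

theorem coeffCLM_cosF_sinF (j k : ℕ) : coeffCLM (cosF j) (sinF k) = 0 := by
  rw [coeffCLM_comm, coeffCLM_sinF_cosF]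

theorem coeffCLM_cosF_cosF_of_ne {j k : ℕ} (h : j ≠ k) : coeffCLM (cosF j) (cosF k) = 0 := by
  rw [coeffCLM_cosF_cosF, if_neg (by lia), if_neg (by lia)]
  simp

theorem coeffCLM_sinF_sinF_of_ne {j k : ℕ} (h : j ≠ k) : coeffCLM (sinF j) (sinF k) = 0 := by
  rw [coeffCLM_sinF_sinF, if_neg (by lia), if_neg (by lia)]
  simp

theorem coeffCLM_cosF_zero : coeffCLM (cosF 0) (cosF 0) = 2 * π := by
  simp [coeffCLM_cosF_cosF]

theorem coeffCLM_cosF_self {k : ℕ} (h : k ≠ 0) : coeffCLM (cosF k) (cosF k) = π := by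
  rw [coeffCLM_cosF_cosF, if_pos (by lia), if_neg (by lia)]
  ring

theorem coeffCLM_sinF_self {k : ℕ} (h : k ≠ 0) : coeffCLM (sinF k) (sinF k) = π := by
  rw [coeffCLM_sinF_sinF, if_pos (by lia), if_neg (by lia)]
  ring

theorem sinF_zero : sinF 0 = 0 := by
  ext t
  simp [sinF_apply]

theorem fourierProj_apply (n : ℕ) (f : C2pi) : fourierProj n f =
    (1 / (2 * π)) • coeffCLM (cosF 0) f • cosF 0 +
      ∑ k ∈ Finset.Icc 1 n,
        (1 / π) • (coeffCLM (cosF k) f • cosF k + coeffCLM (sinF k) f • sinF k) := by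
  simp [fourierProj]

theorem fourierProj_cosF_of_le {n k : ℕ} (h : k ≤ n) : fourierProj n (cosF k) = cosF k := by
  rw [fourierProj_apply]
  simp only [coeffCLM_sinF_cosF, zero_smul, add_zero]
  rcases Nat.eq_zero_or_pos k with rfl | hk
  · rw [Finset.sum_eq_zero, coeffCLM_cosF_zero, smul_smul,
      one_div_mul_cancel (by positivity), one_smul, add_zero]
    intro j hj
    rw [coeffCLM_cosF_cosF_of_ne (by grind), zero_smul, smul_zero]
  · rw [Finset.sum_eq_single_of_mem k (by grind), coeffCLM_cosF_cosF_of_ne hk.ne,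
      coeffCLM_cosF_self hk.ne', smul_smul (1 / π),
      one_div_mul_cancel (by positivity), one_smul, zero_smul, smul_zero, zero_add]
    intro j _ hj
    rw [coeffCLM_cosF_cosF_of_ne hj, zero_smul, smul_zero]

theorem fourierProj_sinF_of_le {n k : ℕ} (h : k ≤ n) : fourierProj n (sinF k) = sinF k := by
  rcases Nat.eq_zero_or_pos k with rfl | hk
  · rw [sinF_zero, map_zero]
  rw [fourierProj_apply]
  simp only [coeffCLM_cosF_sinF, zero_smul, zero_add, smul_zero]
  rw [Finset.sum_eq_single_of_mem k (by grind), coeffCLM_sinF_self hk.ne', smul_smul,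
    one_div_mul_cancel (by positivity), one_smul]
  intro j _ hj
  rw [coeffCLM_sinF_sinF_of_ne hj, zero_smul, smul_zero]

theorem fourierProj_cosF_of_lt {n k : ℕ} (h : n < k) : fourierProj n (cosF k) = 0 := by
  rw [fourierProj_apply, coeffCLM_cosF_cosF_of_ne (by lia), Finset.sum_eq_zero]
  · simp
  · intro j hj
    rw [coeffCLM_cosF_cosF_of_ne (by grind), coeffCLM_sinF_cosF]
    simp

theorem fourierProj_sinF_of_lt {n k : ℕ} (h : n < k) : fourierProj n (sinF k) = 0 := by
  rw [fourierProj_apply, coeffCLM_cosF_sinF, Finset.sum_eq_zero]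
  · simp
  · intro j hj
    rw [coeffCLM_sinF_sinF_of_ne (by grind), coeffCLM_cosF_sinF]
    simp

theorem coeffCLM_cosF_eq_zero_of_mem_trigPoly {n k : ℕ} (h : n < k) {f : C2pi}
    (hf : f ∈ trigPoly n) : coeffCLM (cosF k) f = 0 := by
  suffices trigPoly n ≤ (coeffCLM (cosF k)).ker from this hf
  refine Submodule.span_le.2 ?_
  rintro _ ⟨j, hj, rfl | rfl⟩
  · exact coeffCLM_cosF_cosF_of_ne (by lia)
  · exact coeffCLM_cosF_sinF _ _

theorem coeffCLM_sinF_eq_zero_of_mem_trigPoly {n k : ℕ} (h : n < k) {f : C2pi}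
    (hf : f ∈ trigPoly n) : coeffCLM (sinF k) f = 0 := by
  suffices trigPoly n ≤ (coeffCLM (sinF k)).ker from this hf
  refine Submodule.span_le.2 ?_
  rintro _ ⟨j, hj, rfl | rfl⟩
  · exact coeffCLM_sinF_cosF _ _
  · exact coeffCLM_sinF_sinF_of_ne (by lia)

theorem translateBy_apply (g : ℝ) (f : C2pi) (t : AddCircle (2 * π)) :
    translateBy g f t = f (t + (g : AddCircle (2 * π))) := rfl

theorem fourier_translate (m : ℤ) (t s : AddCircle (2 * π)) :
    fourier m (t + s) = fourier m t * fourier m s := by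
  simp only [fourier_apply, smul_add, AddCircle.toCircle_add, Circle.coe_mul]

theorem translateBy_cosF (g : ℝ) (k : ℕ) :
    translateBy g (cosF k) = cosF k g • cosF k - sinF k g • sinF k := by
  ext t
  simp only [translateBy_apply, cosF_apply, sinF_apply, fourier_translate, Complex.mul_re,
    ContinuousMap.sub_apply, ContinuousMap.smul_apply, smul_eq_mul]
  ring

theorem translateBy_sinF (g : ℝ) (k : ℕ) :
    translateBy g (sinF k) = sinF k g • cosF k + cosF k g • sinF k := by
  ext t
  simp only [translateBy_apply, cosF_apply, sinF_apply, fourier_translate, Complex.mul_im,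
    ContinuousMap.add_apply, ContinuousMap.smul_apply, smul_eq_mul]
  ring

theorem map_cosF_of_commutes {P : C2pi →L[ℝ] C2pi}
    (hPcomm : ∀ (g : ℝ) (f : C2pi), P (translateBy g f) = translateBy g (P f)) (k : ℕ) :
    P (cosF k) = P (cosF k) 0 • cosF k - P (sinF k) 0 • sinF k := by
  ext s
  induction s using QuotientAddGroup.induction_on with | H g =>
  have h := DFunLike.congr_fun (hPcomm g (cosF k)) 0
  rw [translateBy_apply, zero_add, translateBy_cosF, map_sub, map_smul, map_smul] at h
  refine h.symm.trans ?_
  simp only [ContinuousMap.sub_apply, ContinuousMap.smul_apply, smul_eq_mul, mul_comm]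

theorem map_sinF_of_commutes {P : C2pi →L[ℝ] C2pi}
    (hPcomm : ∀ (g : ℝ) (f : C2pi), P (translateBy g f) = translateBy g (P f)) (k : ℕ) :
    P (sinF k) = P (cosF k) 0 • sinF k + P (sinF k) 0 • cosF k := by
  ext s
  induction s using QuotientAddGroup.induction_on with | H g =>
  have h := DFunLike.congr_fun (hPcomm g (sinF k)) 0
  rw [translateBy_apply, zero_add, translateBy_sinF, map_add, map_smul, map_smul] at h
  refine h.symm.trans ?_
  simp only [ContinuousMap.add_apply, ContinuousMap.smul_apply, smul_eq_mul, mul_comm]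

theorem map_eq_zero_of_commutes {n k : ℕ} {P : C2pi →L[ℝ] C2pi}
    (hPcomm : ∀ (g : ℝ) (f : C2pi), P (translateBy g f) = translateBy g (P f))
    (hPrange : ∀ f : C2pi, P f ∈ trigPoly n) (h : n < k) :
    P (cosF k) = 0 ∧ P (sinF k) = 0 := by
  have hk : k ≠ 0 := by lia
  have hc := coeffCLM_cosF_eq_zero_of_mem_trigPoly h (hPrange (cosF k))
  have hs := coeffCLM_sinF_eq_zero_of_mem_trigPoly h (hPrange (cosF k))
  rw [map_cosF_of_commutes hPcomm, map_sub, map_smul, map_smul] at hc hs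
  simp only [coeffCLM_cosF_self hk, coeffCLM_sinF_self hk, coeffCLM_cosF_sinF,
    coeffCLM_sinF_cosF, smul_eq_mul, mul_zero, sub_zero, zero_sub, neg_eq_zero, mul_eq_zero,
    Real.pi_ne_zero, or_false] at hc hs
  rw [map_cosF_of_commutes hPcomm, map_sinF_of_commutes hPcomm, hc, hs]
  simp

/-- A closed subspace of `C(2π)` containing all `cos (k t)` and `sin (k t)` is everything. -/
theorem eq_top_of_cosF_mem_of_sinF_mem {W : Submodule ℝ C2pi} (hW : IsClosed (W : Set C2pi))
    (hcos : ∀ k, cosF k ∈ W) (hsin : ∀ k, sinF k ∈ W) : W = ⊤ := by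
  let re : C(AddCircle (2 * π), ℂ) →L[ℝ] C2pi := Complex.reCLM.compLeftContinuous ℝ _
  let im : C(AddCircle (2 * π), ℂ) →L[ℝ] C2pi := Complex.imCLM.compLeftContinuous ℝ _
  let V : Submodule ℂ C(AddCircle (2 * π), ℂ) :=
    { carrier := {f | re f ∈ W ∧ im f ∈ W}
      zero_mem' := by simp
      add_mem' := fun {f g} hf hg => by
        simp only [Set.mem_ofPred_eq, map_add]
        exact ⟨W.add_mem hf.1 hg.1, W.add_mem hf.2 hg.2⟩
      smul_mem' := fun c f hf => by
        have hre : re (c • f) = c.re • re f - c.im • im f := by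
          ext t
          simp [re, im]
        have him : im (c • f) = c.re • im f + c.im • re f := by
          ext t
          simp [re, im]
        rw [Set.mem_ofPred_eq, hre, him]
        exact ⟨W.sub_mem (W.smul_mem _ hf.1) (W.smul_mem _ hf.2),
          W.add_mem (W.smul_mem _ hf.2) (W.smul_mem _ hf.1)⟩ }
  have hV : IsClosed (V : Set C(AddCircle (2 * π), ℂ)) :=
    (hW.preimage re.continuous).inter (hW.preimage im.continuous)
  have hfourier : Submodule.span ℂ (Set.range (fourier (T := 2 * π))) ≤ V := by
    refine Submodule.span_le.2 ?_
    rintro _ ⟨m, rfl⟩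
    rcases Int.eq_nat_or_neg m with ⟨k, rfl | rfl⟩
    · exact ⟨hcos k, hsin k⟩
    · have hre : re (fourier (-(k : ℤ))) = cosF k := by
        ext t
        change (fourier (-(k : ℤ)) t).re = (fourier (k : ℤ) t).re
        rw [fourier_neg, Complex.conj_re]
      have him : im (fourier (-(k : ℤ))) = -sinF k := by
        ext t
        change (fourier (-(k : ℤ)) t).im = -(fourier (k : ℤ) t).im
        rw [fourier_neg, Complex.conj_im]
      exact ⟨hre ▸ hcos k, him ▸ W.neg_mem (hsin k)⟩
  have htop : (⊤ : Submodule ℂ C(AddCircle (2 * π), ℂ)) ≤ V :=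
    span_fourier_closure_eq_top.ge.trans (Submodule.topologicalClosure_minimal _ hfourier hV)
  refine eq_top_iff.2 fun f _ => ?_
  exact (htop (x := Complex.ofRealCLM.compLeftContinuous ℝ _ f) trivial).1

/-- The Fourier projection `F_n` is the unique projection of `C(2π)` onto `Π_n` that
commutes with all translations `T_g`. -/
theorem fourierProj_unique_commuting_projection (n : ℕ) (P : C2pi →L[ℝ] C2pi)
    (hPrange : ∀ f : C2pi, P f ∈ trigPoly n)
    (hPproj : ∀ f ∈ trigPoly n, P f = f)
    (hPcomm : ∀ (g : ℝ) (f : C2pi), P (translateBy g f) = translateBy g (P f)) :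
    P = fourierProj n := by
  have hW : LinearMap.eqLocus P.toLinearMap (fourierProj n).toLinearMap = ⊤ := by
    refine eq_top_of_cosF_mem_of_sinF_mem
      (isClosed_eq P.continuous (fourierProj n).continuous) (fun k => ?_) (fun k => ?_)
    · change P (cosF k) = fourierProj n (cosF k)
      rcases le_or_gt k n with h | h
      · rw [fourierProj_cosF_of_le h, hPproj _ (Submodule.subset_span ⟨k, h, .inl rfl⟩)]
      · rw [fourierProj_cosF_of_lt h, (map_eq_zero_of_commutes hPcomm hPrange h).1]
    · change P (sinF k) = fourierProj n (sinF k)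
      rcases le_or_gt k n with h | h
      · rw [fourierProj_sinF_of_le h, hPproj _ (Submodule.subset_span ⟨k, h, .inr rfl⟩)]
      · rw [fourierProj_sinF_of_lt h, (map_eq_zero_of_commutes hPcomm hPrange h).2]
  ext1 f
  exact hW.ge (Submodule.mem_top (x := f))
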